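/- Let φ : ℝ → ℝ be nonnegative and nonincreasing on (0,∞), and let C₁, C₂, C₄ > 0 and n > 0 be constants. Suppose α_n > 0 satisfies ∫_{C₁ α_n}^{C₂ √α_n} φ(u) du ≤ C₄ √n · α_n (interval integral, with the convention that the integral is taken from lower to upper limit and may be nonpositive when the limits cross). Then every α ≥ α_n also satisfies ∫_{C₁ α}^{C₂ √α} φ(u) du ≤ C₄ √n · α. -/

import Mathlib

open MeasureTheory intervalIntegral

/-- A function that is nonincreasing on `(0, ∞)` is integrable on compact intervals there. -/
theorem intervalIntegrable_of_antitone_pos {φ : ℝ → ℝ}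
    (hφ : ∀ u v : ℝ, 0 < u → u ≤ v → φ v ≤ φ u) {a b : ℝ} (ha : 0 < a) (hb : 0 < b) :
    IntervalIntegrable φ volume a b :=
  AntitoneOn.intervalIntegrable fun _ hx y _ hxy =>
    hφ _ y ((lt_min ha hb).trans_le hx.1) hxy

/-- Dilating an interval of `(0, ∞)` by `s ≥ 1` multiplies the integral of a nonincreasing
function by at most `s`. -/
theorem integral_dilation_le_of_antitone_pos {φ : ℝ → ℝ}
    (hφ : ∀ u v : ℝ, 0 < u → u ≤ v → φ v ≤ φ u) {a b s : ℝ} (ha : 0 < a) (hab : a ≤ b)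
    (hs : 1 ≤ s) : ∫ u in s * a..s * b, φ u ≤ s * ∫ u in a..b, φ u := by
  have hs0 : 0 < s := one_pos.trans_le hs
  rw [← mul_integral_comp_mul_left]
  refine mul_le_mul_of_nonneg_left (integral_mono_on hab ?_ ?_ ?_) hs0.le
  · exact intervalIntegrable_of_antitone_pos
      (fun u v hu huv => hφ _ _ (mul_pos hs0 hu) (mul_le_mul_of_nonneg_left huv hs0.le))
      ha (ha.trans_le hab)
  · exact intervalIntegrable_of_antitone_pos hφ ha (ha.trans_le hab)
  · intro x hx
    have hx0 : 0 < x := ha.trans_le hx.1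
    exact hφ _ _ hx0 (le_mul_of_one_le_left hx0.le hs)

theorem stmt2 (φ : ℝ → ℝ)
    (hφ0 : ∀ u : ℝ, 0 < u → 0 ≤ φ u)
    (hφmono : ∀ u v : ℝ, 0 < u → u ≤ v → φ v ≤ φ u)
    (C₁ C₂ C₄ n : ℝ) (hC₁ : 0 < C₁) (hC₂ : 0 < C₂) (hC₄ : 0 < C₄) (hn : 0 < n)
    (αn : ℝ) (hαn : 0 < αn)
    (hbal : ∫ u in C₁ * αn..C₂ * Real.sqrt αn, φ u ≤ C₄ * Real.sqrt n * αn) :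
    ∀ α : ℝ, αn ≤ α →
      ∫ u in C₁ * α..C₂ * Real.sqrt α, φ u ≤ C₄ * Real.sqrt n * α := by
  intro α hα
  have hα0 : 0 < α := hαn.trans_le hα
  have hK : 0 ≤ C₄ * Real.sqrt n := by positivity
  rcases le_total (C₂ * Real.sqrt α) (C₁ * α) with h | h
  · have h0 : 0 ≤ ∫ u in C₂ * Real.sqrt α..C₁ * α, φ u :=
      integral_nonneg h fun u hu => hφ0 u (lt_of_lt_of_le (by positivity) hu.1)
    rw [integral_symm]
    have : 0 ≤ C₄ * Real.sqrt n * α := by positivity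
    linarith
  · obtain ⟨t, ht, rfl⟩ : ∃ t : ℝ, 0 < t ∧ t ^ 2 = αn :=
      ⟨Real.sqrt αn, Real.sqrt_pos.2 hαn, Real.sq_sqrt hαn.le⟩
    obtain ⟨s, hs, rfl⟩ : ∃ s : ℝ, 1 ≤ s ∧ (s * t) ^ 2 = α := by
      refine ⟨Real.sqrt α / t, (one_le_div ht).2 (Real.le_sqrt_of_sq_le hα), ?_⟩
      rw [div_mul_cancel₀ _ ht.ne', Real.sq_sqrt hα0.le]
    have hs0 : 0 < s := one_pos.trans_le hs
    rw [Real.sqrt_sq ht.le] at hbal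
    rw [Real.sqrt_sq (by positivity)] at h ⊢
    have hlo : C₁ * t ^ 2 ≤ s * (C₁ * t ^ 2) := le_mul_of_one_le_left (by positivity) hs
    have hhi : s * (C₁ * t ^ 2) ≤ C₂ * t := by
      refine le_of_mul_le_mul_left ?_ hs0
      linarith
    have hsub : ∫ u in s * (C₁ * t ^ 2)..C₂ * t, φ u ≤ ∫ u in C₁ * t ^ 2..C₂ * t, φ u := by
      have hsplit := integral_add_adjacent_intervals
        (intervalIntegrable_of_antitone_pos hφmono
          (show 0 < C₁ * t ^ 2 by positivity) (show 0 < s * (C₁ * t ^ 2) by positivity))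
        (intervalIntegrable_of_antitone_pos hφmono
          (show 0 < s * (C₁ * t ^ 2) by positivity) (show 0 < C₂ * t by positivity))
      have : 0 ≤ ∫ u in C₁ * t ^ 2..s * (C₁ * t ^ 2), φ u :=
        integral_nonneg hlo fun u hu => hφ0 u (lt_of_lt_of_le (by positivity) hu.1)
      linarith
    calc ∫ u in C₁ * (s * t) ^ 2..C₂ * (s * t), φ u
        = ∫ u in s * (s * (C₁ * t ^ 2))..s * (C₂ * t), φ u := by congr 1 <;> ring
      _ ≤ s * ∫ u in s * (C₁ * t ^ 2)..C₂ * t, φ u :=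
        integral_dilation_le_of_antitone_pos hφmono (by positivity) hhi hs
      _ ≤ s * (C₄ * Real.sqrt n * t ^ 2) :=
        mul_le_mul_of_nonneg_left (hsub.trans hbal) hs0.le
      _ ≤ s * (s * (C₄ * Real.sqrt n * t ^ 2)) :=
        mul_le_mul_of_nonneg_left (le_mul_of_one_le_left (by positivity) hs) hs0.le
      _ = C₄ * Real.sqrt n * (s * t) ^ 2 := by ring
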